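/- arXiv:1010.1557 — 6 statements merged into one kernel-verified Lean document; each statement's English description precedes it below -/
import Mathlib

section
/- Let γ : ℝ → ℝ be twice continuously differentiable, let λ, C ∈ ℝ, and let U ⊆ ℝ² \ {(0,0)} be an open set on which there is a differentiable branch of the angle function θ : U → ℝ, i.e. ∇θ(x,y) = (−y, x)/(x² + y²). Define z := λ θ + C, ν₃ := (1 + |∇z|²)^{−1/2} = (1 + λ²/(x²+y²))^{−1/2}, and 1/μ₂(t) := γ(t) − t γ'(t). Then the planar vector field (x,y) ↦ ν₃ · (γ(ν₃) − ν₃ γ'(ν₃)) · ∇z(x,y) has identically zero divergence on U. (Equivalently: the classical helicoids z = λθ + C have zero anisotropic mean curvature for every axially symmetric anisotropic energy density.) -/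
/-- Two-dimensional divergence of a planar vector field. -/
noncomputable def div2 (F : ℝ × ℝ → ℝ × ℝ) (p : ℝ × ℝ) : ℝ :=
  fderiv ℝ (fun q => (F q).1) p (1, 0) + fderiv ℝ (fun q => (F q).2) p (0, 1)

/-- the classical helicoids `z = λθ + C` have zero anisotropic mean curvature
for every axially symmetric anisotropic energy density `γ = γ(ν₃)`:
the field `ν₃ (γ(ν₃) − ν₃ γ'(ν₃)) ∇z` is divergence free. -/
theorem helicoid_zero_anisotropic_mean_curvature
    (γ : ℝ → ℝ) (hγ : ContDiff ℝ 2 γ) (lam C : ℝ)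
    (U : Set (ℝ × ℝ)) (hU : IsOpen U) (hU0 : ∀ p ∈ U, p ≠ (0, 0))
    (θ : ℝ × ℝ → ℝ)
    (hθd : ∀ p ∈ U, DifferentiableAt ℝ θ p)
    (hθx : ∀ p ∈ U, fderiv ℝ θ p (1, 0) = -p.2 / (p.1 ^ 2 + p.2 ^ 2))
    (hθy : ∀ p ∈ U, fderiv ℝ θ p (0, 1) = p.1 / (p.1 ^ 2 + p.2 ^ 2))
    (z : ℝ × ℝ → ℝ) (hz : ∀ p, z p = lam * θ p + C)
    (ν₃ : ℝ × ℝ → ℝ)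
    (hν₃ : ∀ p : ℝ × ℝ, ν₃ p = (Real.sqrt (1 + lam ^ 2 / (p.1 ^ 2 + p.2 ^ 2)))⁻¹) :
    ∀ p ∈ U,
      div2 (fun q =>
        (ν₃ q * (γ (ν₃ q) - ν₃ q * deriv γ (ν₃ q)))
          • (fderiv ℝ z q (1, 0), fderiv ℝ z q (0, 1))) p = 0 := by
  intro p hp
  have hs : 0 < p.1 ^ 2 + p.2 ^ 2 := by
    have h0 := hU0 p hp
    rcases eq_or_ne p.1 0 with h1 | h1
    · have h2 : p.2 ≠ 0 := fun h2 => h0 (Prod.ext h1 h2)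
      positivity
    · positivity
  let n : ℝ → ℝ := fun s => (Real.sqrt (1 + lam ^ 2 / s))⁻¹
  let h : ℝ → ℝ := fun s => n s * (γ (n s) - n s * deriv γ (n s)) * (lam / s)
  have hγ1 : Differentiable ℝ γ := hγ.differentiable (by norm_num)
  have hγ2 : Differentiable ℝ (deriv γ) :=
    (ContDiff.deriv' (n := 1) (by simpa [one_add_one_eq_two] using hγ)).differentiable (by norm_num)
  have hn : DifferentiableAt ℝ n (p.1 ^ 2 + p.2 ^ 2) := by
    have hpos : 0 < 1 + lam ^ 2 / (p.1 ^ 2 + p.2 ^ 2) := by positivity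
    refine DifferentiableAt.inv (DifferentiableAt.sqrt ?_ hpos.ne') (Real.sqrt_pos.2 hpos).ne'
    exact (differentiableAt_const _).add
      ((differentiableAt_const _).div differentiableAt_id hs.ne')
  have hh : DifferentiableAt ℝ h (p.1 ^ 2 + p.2 ^ 2) := by
    refine (hn.mul (((hγ1 _).comp _ hn).sub (hn.mul ((hγ2 _).comp _ hn)))).mul ?_
    exact (differentiableAt_const _).div differentiableAt_id hs.ne'
  have hzd : ∀ q ∈ U, ∀ v, fderiv ℝ z q v = lam * fderiv ℝ θ q v := by
    intro q hq v
    have e : z = fun p => lam * θ p + C := funext hz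
    have := (((hθd q hq).hasFDerivAt.const_mul lam).add_const C).fderiv
    rw [e, this]
    simp
  have hS := ((hasFDerivAt_fst (𝕜 := ℝ) (p := p)).pow 2).add
    ((hasFDerivAt_snd (𝕜 := ℝ) (p := p)).pow 2)
  have hc := HasDerivAt.comp_hasFDerivAt (h₂ := h) p hh.hasDerivAt hS
  have H1 := hc.mul (hasFDerivAt_snd (𝕜 := ℝ) (p := p)).neg
  have H2 := hc.mul (hasFDerivAt_fst (𝕜 := ℝ) (p := p))
  have E1 := H1.congr_of_eventuallyEq (f₁ := fun q => ((ν₃ q * (γ (ν₃ q) - ν₃ q * deriv γ (ν₃ q)))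
          • (fderiv ℝ z q (1, 0), fderiv ℝ z q (0, 1))).1) (by
    filter_upwards [hU.mem_nhds hp] with q hq
    simp [hzd q hq, hθx q hq, hν₃, h, n]
    ring)
  have E2 := H2.congr_of_eventuallyEq (f₁ := fun q => ((ν₃ q * (γ (ν₃ q) - ν₃ q * deriv γ (ν₃ q)))
          • (fderiv ℝ z q (1, 0), fderiv ℝ z q (0, 1))).2) (by
    filter_upwards [hU.mem_nhds hp] with q hq
    simp [hzd q hq, hθy q hq, hν₃, h, n]
    ring)
  unfold div2
  rw [E1.fderiv, E2.fderiv]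
  simp
  ring
end

section
/- Let γ : ℝ → ℝ be twice continuously differentiable, let λ, Λ ∈ ℝ, let 0 < a < b, and let g : (a,b) → ℝ be twice continuously differentiable. On the annulus A = {a < √(x²+y²) < b}, consider the (locally defined, multivalued) function z = g(r) + λθ with r = √(x²+y²), and set ν₃(r) := (1 + g'(r)² + λ²/r²)^{−1/2} and 1/μ₂(t) := γ(t) − t γ'(t). If every local branch of z satisfies Div₀[ν₃ (γ(ν₃) − ν₃ γ'(ν₃)) ∇z] = Λ on its domain, then the function r ↦ ν₃(r) · r · g'(r) · (γ(ν₃(r)) − ν₃(r) γ'(ν₃(r))) − Λ r²/2 is constant on (a,b). -/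
theorem rho_fderiv (q : ℝ × ℝ) (hq : 0 < q.1) :
    HasFDerivAt (fun w : ℝ × ℝ => Real.sqrt (w.1 ^ 2 + w.2 ^ 2))
      ((q.1 / Real.sqrt (q.1 ^ 2 + q.2 ^ 2)) • ContinuousLinearMap.fst ℝ ℝ ℝ +
       (q.2 / Real.sqrt (q.1 ^ 2 + q.2 ^ 2)) • ContinuousLinearMap.snd ℝ ℝ ℝ) q := by
  have h1 : HasFDerivAt (fun w : ℝ × ℝ => w.1) (ContinuousLinearMap.fst ℝ ℝ ℝ) q := hasFDerivAt_fst
  have h2 : HasFDerivAt (fun w : ℝ × ℝ => w.2) (ContinuousLinearMap.snd ℝ ℝ ℝ) q := hasFDerivAt_snd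
  have h3 := ((h1.pow 2).add (h2.pow 2)).sqrt
    (show q.1 ^ 2 + q.2 ^ 2 ≠ 0 by positivity)
  have : 0 < Real.sqrt (q.1 ^ 2 + q.2 ^ 2) := by positivity
  refine h3.congr_fderiv ?_
  ext <;> simp <;> field_simp

theorem theta_fderiv (q : ℝ × ℝ) (hq : 0 < q.1) :
    HasFDerivAt (fun w : ℝ × ℝ => Real.arctan (w.2 / w.1))
      ((-q.2 / (q.1 ^ 2 + q.2 ^ 2)) • ContinuousLinearMap.fst ℝ ℝ ℝ +
       (q.1 / (q.1 ^ 2 + q.2 ^ 2)) • ContinuousLinearMap.snd ℝ ℝ ℝ) q := by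
  have h1 : HasFDerivAt (fun w : ℝ × ℝ => w.1) (ContinuousLinearMap.fst ℝ ℝ ℝ) q := hasFDerivAt_fst
  have h2 : HasFDerivAt (fun w : ℝ × ℝ => w.2) (ContinuousLinearMap.snd ℝ ℝ ℝ) q := hasFDerivAt_snd
  have hi : HasFDerivAt (fun w : ℝ × ℝ => (w.1)⁻¹)
      ((-(q.1 ^ 2)⁻¹) • ContinuousLinearMap.fst ℝ ℝ ℝ) q :=
    (hasDerivAt_inv hq.ne').comp_hasFDerivAt q h1
  have h3 := (h2.mul hi).arctan
  have : 0 < q.1 ^ 2 + q.2 ^ 2 := by positivity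
  simp only [div_eq_mul_inv]
  refine h3.congr_fderiv ?_
  ext <;> simp <;> field_simp

theorem div_radial (u v : ℝ → ℝ) (lam r u' v' : ℝ) (hr : 0 < r)
    (hu : HasDerivAt u u' r) (hv : HasDerivAt v v' r) :
    div2 (fun q => (u (Real.sqrt (q.1 ^ 2 + q.2 ^ 2)) * q.1
        - lam * (v (Real.sqrt (q.1 ^ 2 + q.2 ^ 2)) * q.2),
      u (Real.sqrt (q.1 ^ 2 + q.2 ^ 2)) * q.2
        + lam * (v (Real.sqrt (q.1 ^ 2 + q.2 ^ 2)) * q.1))) (r, 0) = u' * r + 2 * u r := by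
  have hs : Real.sqrt (r ^ 2 + 0 ^ 2) = r := by simp [Real.sqrt_sq hr.le]
  have h0 := rho_fderiv (r, 0) hr
  have h1 : HasFDerivAt (fun w : ℝ × ℝ => w.1) (ContinuousLinearMap.fst ℝ ℝ ℝ) (r, 0) :=
    hasFDerivAt_fst
  have h2 : HasFDerivAt (fun w : ℝ × ℝ => w.2) (ContinuousLinearMap.snd ℝ ℝ ℝ) (r, 0) :=
    hasFDerivAt_snd
  have hU := HasDerivAt.comp_hasFDerivAt (h₂ := u) (h₂' := u') (r, (0:ℝ)) (by simpa only [hs] using hu) h0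
  have hV := HasDerivAt.comp_hasFDerivAt (h₂ := v) (h₂' := v') (r, (0:ℝ)) (by simpa only [hs] using hv) h0
  have hA := (hU.mul h1).sub ((hV.mul h2).const_mul lam)
  have hB := (hU.mul h2).add ((hV.mul h1).const_mul lam)
  have eA := hA.fderiv
  have eB := hB.fderiv
  unfold div2
  erw [eA, eB]
  simp [Real.sqrt_sq hr.le, hr.ne']
  ring

/-- for a helicoidal solution `z = g(r) + λθ` of the constant anisotropic
mean curvature equation `Div₀[ν₃ (γ(ν₃) − ν₃ γ'(ν₃)) ∇z] = Λ` on an annulus,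
the first integral `ν₃ r g' (γ(ν₃) − ν₃ γ'(ν₃)) − Λ r²/2` is constant. -/
theorem helicoidal_first_integral
    (γ : ℝ → ℝ) (hγ : ContDiff ℝ 2 γ) (lam Λ a b : ℝ) (ha : 0 < a) (hab : a < b)
    (g : ℝ → ℝ) (hg : ContDiffOn ℝ 2 g (Set.Ioo a b))
    (ν₃ : ℝ → ℝ)
    (hν₃ : ∀ r : ℝ,
      ν₃ r = (Real.sqrt (1 + (deriv g r) ^ 2 + lam ^ 2 / r ^ 2))⁻¹)
    (hPDE : ∀ (V : Set (ℝ × ℝ)) (θ : ℝ × ℝ → ℝ), IsOpen V →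
      (∀ p ∈ V, Real.sqrt (p.1 ^ 2 + p.2 ^ 2) ∈ Set.Ioo a b) →
      (∀ p ∈ V, DifferentiableAt ℝ θ p) →
      (∀ p ∈ V, fderiv ℝ θ p (1, 0) = -p.2 / (p.1 ^ 2 + p.2 ^ 2)) →
      (∀ p ∈ V, fderiv ℝ θ p (0, 1) = p.1 / (p.1 ^ 2 + p.2 ^ 2)) →
      ∀ p ∈ V,
        div2 (fun q =>
          (ν₃ (Real.sqrt (q.1 ^ 2 + q.2 ^ 2)) *
              (γ (ν₃ (Real.sqrt (q.1 ^ 2 + q.2 ^ 2))) -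
                ν₃ (Real.sqrt (q.1 ^ 2 + q.2 ^ 2)) *
                  deriv γ (ν₃ (Real.sqrt (q.1 ^ 2 + q.2 ^ 2)))))
            • (fderiv ℝ (fun w : ℝ × ℝ =>
                  g (Real.sqrt (w.1 ^ 2 + w.2 ^ 2)) + lam * θ w) q (1, 0),
               fderiv ℝ (fun w : ℝ × ℝ =>
                  g (Real.sqrt (w.1 ^ 2 + w.2 ^ 2)) + lam * θ w) q (0, 1))) p = Λ) :
    ∀ r₁ ∈ Set.Ioo a b, ∀ r₂ ∈ Set.Ioo a b,
      ν₃ r₁ * r₁ * deriv g r₁ * (γ (ν₃ r₁) - ν₃ r₁ * deriv γ (ν₃ r₁)) - Λ * r₁ ^ 2 / 2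
        = ν₃ r₂ * r₂ * deriv g r₂ * (γ (ν₃ r₂) - ν₃ r₂ * deriv γ (ν₃ r₂))
            - Λ * r₂ ^ 2 / 2 := by
  have hg1 : ∀ r ∈ Set.Ioo a b, DifferentiableAt ℝ g r := fun r hr =>
    (hg.contDiffAt (isOpen_Ioo.mem_nhds hr)).differentiableAt (by norm_num)
  have hg2 : ∀ r ∈ Set.Ioo a b, DifferentiableAt ℝ (deriv g) r := fun r hr =>
    ((contDiffOn_succ_iff_deriv_of_isOpen (n := 1) isOpen_Ioo).1
      (by simpa [one_add_one_eq_two] using hg)).2.2.contDiffAt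
        (isOpen_Ioo.mem_nhds hr) |>.differentiableAt (by norm_num)
  have hγ1 : Differentiable ℝ γ := hγ.differentiable (by norm_num)
  have hγ2 : Differentiable ℝ (deriv γ) :=
    ((contDiff_succ_iff_deriv (n := 1)).1
      (by simpa [one_add_one_eq_two] using hγ)).2.2.differentiable (by norm_num)
  have hν : ∀ r ∈ Set.Ioo a b, DifferentiableAt ℝ ν₃ r := by
    intro r hr
    have hr0 : 0 < r := ha.trans hr.1
    have := hg2 r hr
    have hpos : 0 < 1 + (deriv g r) ^ 2 + lam ^ 2 / r ^ 2 := by positivity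
    rw [show ν₃ = _ from funext hν₃]
    refine DifferentiableAt.inv (DifferentiableAt.sqrt ?_ hpos.ne') (Real.sqrt_pos.2 hpos).ne'
    refine ((this.pow 2).const_add 1).add ?_
    exact (differentiableAt_const _).div (differentiableAt_id.pow 2) (by simp; positivity)
  set h : ℝ → ℝ := fun s => ν₃ s * (γ (ν₃ s) - ν₃ s * deriv γ (ν₃ s)) with hh
  have hhd : ∀ r ∈ Set.Ioo a b, DifferentiableAt ℝ h r := by
    intro r hr
    have h1 := hν r hr
    exact h1.mul ((((hγ1 _).comp r h1)).sub (h1.mul ((hγ2 _).comp r h1)))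
  set u : ℝ → ℝ := fun s => h s * deriv g s / s with hu
  have hud : ∀ r ∈ Set.Ioo a b, DifferentiableAt ℝ u r := fun r hr =>
    ((hhd r hr).mul (hg2 r hr)).div differentiableAt_id (ha.trans hr.1).ne'
  set v : ℝ → ℝ := fun s => h s / s ^ 2 with hv
  have hvd : ∀ r ∈ Set.Ioo a b, DifferentiableAt ℝ v r := fun r hr =>
    (hhd r hr).div (differentiableAt_id.pow 2) (pow_ne_zero 2 (ha.trans hr.1).ne')
  have key : ∀ r ∈ Set.Ioo a b, deriv u r * r + 2 * u r = Λ := by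
    intro r hr
    have hr0 : 0 < r := ha.trans hr.1
    set V : Set (ℝ × ℝ) :=
      {p | 0 < p.1} ∩ (fun p : ℝ × ℝ => Real.sqrt (p.1 ^ 2 + p.2 ^ 2)) ⁻¹' Set.Ioo a b with hV
    have hVo : IsOpen V := (isOpen_lt continuous_const continuous_fst).inter
      (isOpen_Ioo.preimage (by fun_prop))
    have hm : (r, (0:ℝ)) ∈ V := ⟨hr0, by simpa [Real.sqrt_sq hr0.le] using hr⟩
    have P := hPDE V (fun w => Real.arctan (w.2 / w.1)) hVo (fun p hp => hp.2)
      (fun p hp => (theta_fderiv p hp.1).differentiableAt)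
      (fun p hp => by rw [(theta_fderiv p hp.1).fderiv]; simp)
      (fun p hp => by rw [(theta_fderiv p hp.1).fderiv]; simp) (r, 0) hm
    rw [← P, ← div_radial u v lam r _ _ hr0 (hud r hr).hasDerivAt (hvd r hr).hasDerivAt]
    have Z : ∀ q ∈ V, HasFDerivAt (fun w : ℝ × ℝ =>
        g (Real.sqrt (w.1 ^ 2 + w.2 ^ 2)) + lam * Real.arctan (w.2 / w.1)) _ q := fun q hq =>
      ((hg1 _ hq.2).hasDerivAt.comp_hasFDerivAt q (rho_fderiv q hq.1)).add
        ((theta_fderiv q hq.1).const_mul lam)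
    have hVn := hVo.mem_nhds hm
    unfold div2
    congr 2
    all_goals
      apply Filter.EventuallyEq.fderiv_eq
      filter_upwards [hVn] with q hq
      rw [(Z q hq).fderiv]
      have h1 : 0 < q.1 := hq.1
      have hs : 0 < Real.sqrt (q.1 ^ 2 + q.2 ^ 2) := by positivity
      have hsq : q.1 ^ 2 + q.2 ^ 2 = Real.sqrt (q.1 ^ 2 + q.2 ^ 2) ^ 2 :=
        (Real.sq_sqrt (by positivity)).symm
      simp only [hu, hv, hh]
      simp
      generalize Real.sqrt (q.1 ^ 2 + q.2 ^ 2) = s at *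
      rw [hsq]
      field_simp
      try ring
  intro r₁ hr₁ r₂ hr₂
  have E : ∀ r ∈ Set.Ioo a b,
      ν₃ r * r * deriv g r * (γ (ν₃ r) - ν₃ r * deriv γ (ν₃ r)) - Λ * r ^ 2 / 2
        = r ^ 2 * u r - Λ * r ^ 2 / 2 := by
    intro r hr
    have hr0 : r ≠ 0 := (ha.trans hr.1).ne'
    simp only [hu, hh]
    field_simp
  rw [E _ hr₁, E _ hr₂]
  have D : ∀ r ∈ Set.Ioo a b,
      HasDerivAt (fun r => r ^ 2 * u r - Λ * r ^ 2 / 2) 0 r := by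
    intro r hr
    have h1 := ((hasDerivAt_pow 2 r).mul (hud r hr).hasDerivAt).sub
      (((hasDerivAt_pow 2 r).const_mul Λ).div_const 2)
    refine h1.congr_deriv ?_
    simp
    linear_combination r * key r hr
  exact isOpen_Ioo.is_const_of_deriv_eq_zero isPreconnected_Ioo
    (fun r hr => (D r hr).differentiableAt.differentiableWithinAt)
    (fun r hr => (D r hr).deriv) hr₁ hr₂
end

section
/- Let (x, y) : I → ℝ² be a twice continuously differentiable unit-speed plane curve (x'(s)² + y'(s)² = 1), let φ : I → ℝ be continuously differentiable with x'(s) + i y'(s) = e^{i φ(s)}, and define η₁(s) := −(1/2) d/ds (x(s)² + y(s)²), η₂(s) := x(s) y'(s) − y(s) x'(s). Then for all s ∈ I: (i) η₂'(s) = −φ'(s) η₁(s), so that wherever η₁ ≠ 0 one has φ' = −η₂'/η₁; and (ii) x(s) + i y(s) = −(η₁(s) + i η₂(s)) e^{i φ(s)}. In particular, the generating curve (x, y) is recovered from its treadmill sled by x + iy = −(η₁ + iη₂) exp(−i ∫ dη₂/η₁). -/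
open Complex

/-- recovery of the generating curve from its treadmill sled.
For a C² unit-speed plane curve with `x' + iy' = e^{iφ}` and treadmill sled
`η₁ = −(1/2)(x²+y²)'`, `η₂ = x y' − y x'`, one has `η₂' = −φ' η₁` (so `φ' = −η₂'/η₁`
wherever `η₁ ≠ 0`), and `x + iy = −(η₁ + iη₂) e^{iφ}`. -/
theorem treadmill_sled_recovery
    (I : Set ℝ) (hI : IsOpen I) (x y x' y' x'' y'' φ φ' : ℝ → ℝ)
    (hx : ∀ s ∈ I, HasDerivAt x (x' s) s)
    (hy : ∀ s ∈ I, HasDerivAt y (y' s) s)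
    (hx' : ∀ s ∈ I, HasDerivAt x' (x'' s) s)
    (hy' : ∀ s ∈ I, HasDerivAt y' (y'' s) s)
    (hφ : ∀ s ∈ I, HasDerivAt φ (φ' s) s)
    (hunit : ∀ s ∈ I, x' s ^ 2 + y' s ^ 2 = 1)
    (hexp : ∀ s ∈ I,
      (x' s : ℂ) + Complex.I * (y' s : ℂ) = Complex.exp (Complex.I * (φ s : ℂ)))
    (η₁ η₂ : ℝ → ℝ)
    (hη₁ : ∀ s, η₁ s = -(1 / 2) * deriv (fun t => x t ^ 2 + y t ^ 2) s)
    (hη₂ : ∀ s, η₂ s = x s * y' s - y s * x' s) :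
    ∀ s ∈ I,
      HasDerivAt η₂ (-(φ' s) * η₁ s) s
      ∧ (η₁ s ≠ 0 → φ' s = -(deriv η₂ s) / η₁ s)
      ∧ (x s : ℂ) + Complex.I * (y s : ℂ)
          = -((η₁ s : ℂ) + Complex.I * (η₂ s : ℂ)) * Complex.exp (Complex.I * (φ s : ℂ)) := by
  have hcs : ∀ s ∈ I, x' s = Real.cos (φ s) ∧ y' s = Real.sin (φ s) := by
    intro s hs
    have h := hexp s hs
    rw [mul_comm Complex.I (φ s : ℂ), Complex.exp_mul_I, ← Complex.ofReal_cos,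
      ← Complex.ofReal_sin] at h
    constructor
    · simpa [-Complex.ofReal_cos, -Complex.ofReal_sin] using congrArg Complex.re h
    · simpa [-Complex.ofReal_cos, -Complex.ofReal_sin] using congrArg Complex.im h
  intro s hs
  have hn : I ∈ nhds s := hI.mem_nhds hs
  have e1 : η₁ s = -(x s * x' s + y s * y' s) := by
    have hd := ((hx s hs).pow 2).add ((hy s hs).pow 2)
    have hd2 : deriv (fun t => x t ^ 2 + y t ^ 2) s = _ := hd.deriv
    rw [hη₁, hd2]
    push_cast
    ring
  have ex : x'' s = -Real.sin (φ s) * φ' s := by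
    refine (hx' s hs).unique ((hφ s hs).cos.congr_of_eventuallyEq ?_)
    filter_upwards [hn] with t ht using (hcs t ht).1
  have ey : y'' s = Real.cos (φ s) * φ' s := by
    refine (hy' s hs).unique ((hφ s hs).sin.congr_of_eventuallyEq ?_)
    filter_upwards [hn] with t ht using (hcs t ht).2
  have hd : HasDerivAt η₂ (-(φ' s) * η₁ s) s := by
    have h := ((hx s hs).mul (hy' s hs)).sub ((hy s hs).mul (hx' s hs))
    have hf : η₂ = x * y' - y * x' := by
      funext t
      simp [hη₂ t]
    rw [hf]
    refine h.congr_deriv ?_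
    rw [e1, ex, ey, (hcs s hs).1, (hcs s hs).2]
    ring
  refine ⟨hd, ?_, ?_⟩
  · intro h0
    rw [hd.deriv]
    field_simp
  · rw [← hexp s hs, e1, hη₂]
    have hu : (x' s : ℂ) ^ 2 + (y' s : ℂ) ^ 2 = 1 := by exact_mod_cast hunit s hs
    have hI2 : Complex.I ^ 2 = -1 := Complex.I_sq
    push_cast
    linear_combination (-(x s : ℂ) - Complex.I * y s) * hu
      + ((x s : ℂ) * y' s ^ 2 - y s * x' s * y' s) * hI2
end

section
/- Let γ : (−1,1) → ℝ be twice continuously differentiable and suppose that for all t ∈ (−1,1): γ(t) − t γ'(t) > 0 and (1 − t²) γ''(t) + γ(t) − t γ'(t) > 0 (i.e. both principal curvatures of the Wulff shape are positive). Then the function h(t) := (1 − t²)(γ(t) − t γ'(t))² attains a strict global maximum on (−1,1) at t = 0; that is, for every t ∈ (−1,1) with t ≠ 0, (1 − t²)(γ(t) − t γ'(t))² < γ(0)². -/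
/-- if both principal curvatures of the axially symmetric Wulff shape are
positive, i.e. `γ − tγ' > 0` and `(1−t²)γ'' + γ − tγ' > 0` on `(−1,1)`, then
`h(t) = (1−t²)(γ(t) − tγ'(t))²` has a strict global maximum at `t = 0`:
`h(t) < γ(0)²` for all `t ≠ 0` in `(−1,1)`. -/
theorem discriminant_strict_max_at_zero
    (γ γ' γ'' : ℝ → ℝ)
    (hγ : ∀ t ∈ Set.Ioo (-1 : ℝ) 1, HasDerivAt γ (γ' t) t)
    (hγ' : ∀ t ∈ Set.Ioo (-1 : ℝ) 1, HasDerivAt γ' (γ'' t) t)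
    (hγ''c : ContinuousOn γ'' (Set.Ioo (-1 : ℝ) 1))
    (hμ₂ : ∀ t ∈ Set.Ioo (-1 : ℝ) 1, 0 < γ t - t * γ' t)
    (hμ₁ : ∀ t ∈ Set.Ioo (-1 : ℝ) 1, 0 < (1 - t ^ 2) * γ'' t + γ t - t * γ' t) :
    ∀ t ∈ Set.Ioo (-1 : ℝ) 1, t ≠ 0 →
      (1 - t ^ 2) * (γ t - t * γ' t) ^ 2 < γ 0 ^ 2 := by
  have hd : ∀ t ∈ Set.Ioo (-1 : ℝ) 1,
      HasDerivAt (fun t => (1 - t ^ 2) * (γ t - t * γ' t) ^ 2)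
        (-2 * t * ((γ t - t * γ' t) * ((1 - t ^ 2) * γ'' t + γ t - t * γ' t))) t := by
    intro t ht
    have h1 : HasDerivAt (fun t => γ t - t * γ' t) (γ' t - (1 * γ' t + t * γ'' t)) t :=
      (hγ t ht).sub ((hasDerivAt_id' t).mul (hγ' t ht))
    have h2 : HasDerivAt (fun t : ℝ => 1 - t ^ 2) (-(2 * t)) t := by
      simpa using (hasDerivAt_pow 2 t).const_sub 1
    have h3 := h2.mul (h1.pow 2)
    refine h3.congr_deriv ?_
    simp
    ring
  have key : ∀ t ∈ Set.Ioo (-1 : ℝ) 1,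
      0 < (γ t - t * γ' t) * ((1 - t ^ 2) * γ'' t + γ t - t * γ' t) :=
    fun t ht => mul_pos (hμ₂ t ht) (hμ₁ t ht)
  intro t ht hne
  obtain ⟨ht1, ht2⟩ := ht
  rcases lt_or_gt_of_ne hne with h | h
  · have hin : ∀ x ∈ Set.Icc t 0, x ∈ Set.Ioo (-1 : ℝ) 1 :=
      fun x hx => ⟨by linarith [hx.1], by linarith [hx.2]⟩
    obtain ⟨c, hc, he⟩ := exists_hasDerivAt_eq_slope _ _ h
      (fun x hx => (hd x (hin x hx)).continuousAt.continuousWithinAt)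
      (fun x hx => hd x (hin x (Set.Ioo_subset_Icc_self hx)))
    have hk := key c (hin c (Set.Ioo_subset_Icc_self hc))
    have hp := mul_pos (by linarith [hc.2] : 0 < -2 * c) hk
    rw [he, div_pos_iff_of_pos_right (by linarith)] at hp
    simp at hp
    linarith
  · have hin : ∀ x ∈ Set.Icc 0 t, x ∈ Set.Ioo (-1 : ℝ) 1 :=
      fun x hx => ⟨by linarith [hx.1], by linarith [hx.2]⟩
    obtain ⟨c, hc, he⟩ := exists_hasDerivAt_eq_slope _ _ h
      (fun x hx => (hd x (hin x hx)).continuousAt.continuousWithinAt)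
      (fun x hx => hd x (hin x (Set.Ioo_subset_Icc_self hx)))
    have hk := key c (hin c (Set.Ioo_subset_Icc_self hc))
    have hp := mul_neg_of_neg_of_pos (by linarith [hc.1] : -2 * c < 0) hk
    rw [he, div_neg_iff] at hp
    simp at hp
    rcases hp with hp | hp
    · linarith [hp.2]
    · linarith [hp.1]
end

section
/- Let p ≥ 2 be a positive even integer, let f : (0,∞) → ℝ be continuously differentiable, define ω(x,y) := (x^p + y^p)^{1/p}, and let U ⊆ ℝ² \ {(0,0)} be open. Suppose w : U → ℝ is differentiable with w_x(x,y) = −f(ω(x,y)) y and w_y(x,y) = f(ω(x,y)) x on U. Then w satisfies M_q[w] = Div₀( [1 + w_x^p + w_y^p]^{(1−p)/p} (w_x^{p−1}, w_y^{p−1}) ) = 0 on U. (Thus the multivalued ruled graph w is a generalized helicoid: it has zero anisotropic mean curvature for the functional whose Wulff shape is the unit sphere W_q of the dual p-norm.) -/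
/-- if `∇w = f(ω)(−y, x)` with `ω = (x^p+y^p)^{1/p}`, then `w` satisfies
`M_q[w] = Div₀([1 + w_x^p + w_y^p]^{(1−p)/p}(w_x^{p−1}, w_y^{p−1})) = 0`, i.e. the
multivalued ruled graph of `w` is a generalized helicoid with zero anisotropic mean
curvature for the Wulff shape `W_q`. -/
theorem generalized_helicoid_zero_amc
    (p : ℕ) (hp : Even p) (hp2 : 2 ≤ p)
    (f f' : ℝ → ℝ)
    (hf : ∀ t ∈ Set.Ioi (0 : ℝ), HasDerivAt f (f' t) t)
    (hf' : ContinuousOn f' (Set.Ioi (0 : ℝ)))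
    (ω : ℝ × ℝ → ℝ)
    (hω : ∀ q : ℝ × ℝ, ω q = (q.1 ^ p + q.2 ^ p) ^ ((1 : ℝ) / p))
    (U : Set (ℝ × ℝ)) (hU : IsOpen U) (hU0 : ∀ q ∈ U, q ≠ (0, 0))
    (w : ℝ × ℝ → ℝ)
    (hwd : ∀ q ∈ U, DifferentiableAt ℝ w q)
    (hwx : ∀ q ∈ U, fderiv ℝ w q (1, 0) = -(f (ω q)) * q.2)
    (hwy : ∀ q ∈ U, fderiv ℝ w q (0, 1) = f (ω q) * q.1) :
    ∀ q ∈ U,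
      div2 (fun v =>
        ((1 + (fderiv ℝ w v (1, 0)) ^ p + (fderiv ℝ w v (0, 1)) ^ p)
            ^ (((1 : ℝ) - p) / p))
          • ((fderiv ℝ w v (1, 0)) ^ (p - 1), (fderiv ℝ w v (0, 1)) ^ (p - 1))) q
        = 0 := by
  intro q hq
  have hpne : p ≠ 0 := by omega
  have hodd : Odd (p - 1) := Nat.Even.sub_odd (by omega) hp odd_one
  have hS : 0 < q.1 ^ p + q.2 ^ p := by
    by_cases h1 : q.1 = 0
    · have h2 : q.2 ≠ 0 := fun h2 => hU0 q hq (Prod.ext h1 h2)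
      have := hp.pow_pos h2
      have := hp.pow_nonneg q.1
      linarith
    · have := hp.pow_pos h1
      have := hp.pow_nonneg q.2
      linarith
  set S : ℝ := q.1 ^ p + q.2 ^ p with hSdef
  let G : ℝ → ℝ := fun s => (1 + (f (s ^ ((1 : ℝ) / p))) ^ p * s) ^ (((1 : ℝ) - p) / p)
    * (f (s ^ ((1 : ℝ) / p))) ^ (p - 1)
  have hg : DifferentiableAt ℝ (fun s : ℝ => f (s ^ ((1 : ℝ) / p))) S := by
    have h1 : DifferentiableAt ℝ (fun s : ℝ => s ^ ((1 : ℝ) / p)) S :=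
      (Real.hasDerivAt_rpow_const (Or.inl hS.ne')).differentiableAt
    exact DifferentiableAt.comp (g := f) S
      (hf _ (Real.rpow_pos_of_pos hS _)).differentiableAt h1
  have hG : DifferentiableAt ℝ G S := by
    have hb : 0 < 1 + (f (S ^ ((1 : ℝ) / p))) ^ p * S := by
      have := hp.pow_nonneg (f (S ^ ((1 : ℝ) / p)))
      positivity
    refine DifferentiableAt.mul ?_ (hg.pow _)
    refine DifferentiableAt.rpow_const ?_ (Or.inl hb.ne')
    exact (differentiableAt_const _).add ((hg.pow _).mul differentiableAt_id)
  have hev : (fun v : ℝ × ℝ =>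
        ((1 + (fderiv ℝ w v (1, 0)) ^ p + (fderiv ℝ w v (0, 1)) ^ p)
            ^ (((1 : ℝ) - p) / p))
          • ((fderiv ℝ w v (1, 0)) ^ (p - 1), (fderiv ℝ w v (0, 1)) ^ (p - 1)))
      =ᶠ[nhds q] fun v => (-(G (v.1 ^ p + v.2 ^ p) * v.2 ^ (p - 1)),
        G (v.1 ^ p + v.2 ^ p) * v.1 ^ (p - 1)) := by
    filter_upwards [hU.mem_nhds hq] with v hv
    rw [hwx v hv, hwy v hv, hω v]
    have e : ∀ a : ℝ, 1 + (-a * v.2) ^ p + (a * v.1) ^ p = 1 + a ^ p * (v.1 ^ p + v.2 ^ p) := by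
      intro a
      rw [mul_pow, mul_pow, hp.neg_pow]; ring
    rw [e]
    simp only [G, Prod.smul_mk, smul_eq_mul, mul_pow, hodd.neg_pow]
    ext <;> simp only <;> ring
  have h1 : HasFDerivAt (fun v : ℝ × ℝ => v.1) (ContinuousLinearMap.fst ℝ ℝ ℝ) q := hasFDerivAt_fst
  have h2 : HasFDerivAt (fun v : ℝ × ℝ => v.2) (ContinuousLinearMap.snd ℝ ℝ ℝ) q := hasFDerivAt_snd
  have hGS := (hG.hasDerivAt).comp_hasFDerivAt q ((h1.pow p).add (h2.pow p))
  have hA := (hGS.mul (h2.pow (p - 1))).neg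
  have hB := hGS.mul (h1.pow (p - 1))
  have eA := (hev.fun_comp Prod.fst).fderiv_eq.trans hA.fderiv
  have eB := (hev.fun_comp Prod.snd).fderiv_eq.trans hB.fderiv
  unfold div2
  simp only [Function.comp_def] at eA eB
  rw [eA, eB]
  simp
  ring
end

section
/- Let J : ℝ² → ℝ² be J(x,y) = (−y, x). Let Ψ* : ℝ² \ {0} → ℝ be twice continuously differentiable, positive, positively homogeneous of degree one (Ψ*(tv) = t Ψ*(v) for t > 0), and J-invariant: Ψ*(Jv) = Ψ*(v) for all v ≠ 0. Let Φ* : ℝ² → ℝ be twice continuously differentiable, let g : (0,∞) → ℝ be continuously differentiable and positive, let U ⊆ ℝ² \ {0} be open, and let α : U → ℝ be differentiable with ∇α(x,y) = g(Ψ*(x,y)) · (−y, x) on U. Then the planar vector field (x,y) ↦ [∂₁Φ*( Ψ*(∇α(x,y)), 1 )] · (∇Ψ*)(∇α(x,y)) has identically zero divergence on U, where ∂₁Φ* denotes the partial derivative of Φ* in its first argument. (Hence the graph of α has zero anisotropic mean curvature for the functional with Wulff shape W = {‖ξ‖ = 1}.) -/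
/-- Planar gradient of a function of two variables. -/
noncomputable def grad2 (f : ℝ × ℝ → ℝ) (v : ℝ × ℝ) : ℝ × ℝ :=
  (fderiv ℝ f v (1, 0), fderiv ℝ f v (0, 1))

/-- anisotropic helicoids. If `Ψ*` is positive, degree-one homogeneous,
`J`-invariant (`J(x,y) = (−y,x)`) and C² away from `0`, `Φ*` is C², `g > 0` is C¹, and
`∇α = g(Ψ*(x,y)) J(x,y)` on an open set `U ⊆ ℝ² \ {0}`, then the field
`[∂₁Φ*(Ψ*(∇α),1)] ∇Ψ*|_{∇α}` is divergence free on `U`, so the graph of `α` has zero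
anisotropic mean curvature for the functional with Wulff shape `W = {‖ξ‖ = 1}`. -/
theorem anisotropic_helicoid_zero_amc
    (Ψs : ℝ × ℝ → ℝ) (Φs : ℝ × ℝ → ℝ)
    (hΨsmooth : ContDiffOn ℝ 2 Ψs {v : ℝ × ℝ | v ≠ 0})
    (hΨpos : ∀ v : ℝ × ℝ, v ≠ 0 → 0 < Ψs v)
    (hΨhom : ∀ t : ℝ, 0 < t → ∀ v : ℝ × ℝ, v ≠ 0 → Ψs (t • v) = t * Ψs v)
    (hΨJ : ∀ v : ℝ × ℝ, v ≠ 0 → Ψs (-v.2, v.1) = Ψs v)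
    (hΦsmooth : ContDiff ℝ 2 Φs)
    (g g' : ℝ → ℝ)
    (hg : ∀ t ∈ Set.Ioi (0 : ℝ), HasDerivAt g (g' t) t)
    (hg' : ContinuousOn g' (Set.Ioi (0 : ℝ)))
    (hgpos : ∀ t ∈ Set.Ioi (0 : ℝ), 0 < g t)
    (U : Set (ℝ × ℝ)) (hU : IsOpen U) (hU0 : ∀ q ∈ U, q ≠ (0 : ℝ × ℝ))
    (α : ℝ × ℝ → ℝ)
    (hαd : ∀ q ∈ U, DifferentiableAt ℝ α q)
    (hαx : ∀ q ∈ U, fderiv ℝ α q (1, 0) = g (Ψs q) * (-q.2))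
    (hαy : ∀ q ∈ U, fderiv ℝ α q (0, 1) = g (Ψs q) * q.1) :
    ∀ q ∈ U,
      div2 (fun v =>
        (fderiv ℝ Φs (Ψs (grad2 α v), 1) (1, 0)) • grad2 Ψs (grad2 α v)) q = 0 := by
  have hopen : IsOpen {v : ℝ × ℝ | v ≠ 0} := isOpen_ne
  have hC : ∀ v : ℝ × ℝ, v ≠ 0 → ContDiffAt ℝ 2 Ψs v := fun v hv =>
    hΨsmooth.contDiffAt (hopen.mem_nhds hv)
  have hD : ∀ v : ℝ × ℝ, v ≠ 0 → DifferentiableAt ℝ Ψs v := fun v hv =>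
    (hC v hv).differentiableAt (by norm_num)
  have hJ0 : ∀ v : ℝ × ℝ, v ≠ 0 → ((-v.2, v.1) : ℝ × ℝ) ≠ 0 := by
    intro v hv h
    apply hv
    have h1 := congrArg Prod.fst h
    have h2 := congrArg Prod.snd h
    simp at h1 h2
    exact Prod.ext h2 h1
  have hval : ∀ s : ℝ, 0 < s → ∀ v : ℝ × ℝ, v ≠ 0 →
      Ψs (s • ((-v.2, v.1) : ℝ × ℝ)) = s * Ψs v := by
    intro s hs v hv
    rw [hΨhom s hs _ (hJ0 v hv), hΨJ v hv]
  have hgrad : ∀ s : ℝ, 0 < s → ∀ v : ℝ × ℝ, v ≠ 0 →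
      grad2 Ψs (s • ((-v.2, v.1) : ℝ × ℝ)) = (-(fderiv ℝ Ψs v (0, 1)), fderiv ℝ Ψs v (1, 0)) := by
    intro s hs v hv
    let L : ℝ × ℝ →L[ℝ] ℝ × ℝ :=
      s • ((-(ContinuousLinearMap.snd ℝ ℝ ℝ)).prod (ContinuousLinearMap.fst ℝ ℝ ℝ))
    have hL : ∀ w : ℝ × ℝ, L w = s • ((-w.2, w.1) : ℝ × ℝ) := fun w => rfl
    have hne : L v ≠ 0 := by
      rw [hL]; exact smul_ne_zero hs.ne' (hJ0 v hv)
    have h1 : HasFDerivAt (fun w => Ψs (L w)) ((fderiv ℝ Ψs (L v)).comp L) v :=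
      (hD _ hne).hasFDerivAt.comp v L.hasFDerivAt
    have h2 : HasFDerivAt (fun w => s * Ψs w) (s • fderiv ℝ Ψs v) v :=
      (hD v hv).hasFDerivAt.const_mul s
    have h3 : (fun w => Ψs (L w)) =ᶠ[nhds v] (fun w => s * Ψs w) := by
      filter_upwards [hopen.mem_nhds hv] with w hw
      rw [hL, hval s hs w hw]
    have h4 := (h2.congr_of_eventuallyEq h3).unique h1
    have e1 : L (1, 0) = s • ((0, 1) : ℝ × ℝ) := by rw [hL]; simp
    have e2 : L (0, 1) = (-s) • ((1, 0) : ℝ × ℝ) := by rw [hL]; simp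
    have h5 := DFunLike.congr_fun h4 (1, 0)
    have h6 := DFunLike.congr_fun h4 (0, 1)
    rw [ContinuousLinearMap.comp_apply, e1, map_smul] at h5
    rw [ContinuousLinearMap.comp_apply, e2, map_smul] at h6
    simp only [ContinuousLinearMap.smul_apply, smul_eq_mul] at h5 h6
    rw [← hL]
    unfold grad2
    have h5' := mul_left_cancel₀ hs.ne' h5
    have h6' : fderiv ℝ Ψs (L v) (1, 0) = -(fderiv ℝ Ψs v (0, 1)) := by
      apply mul_left_cancel₀ hs.ne'
      linarith
    rw [h6', h5']
  intro q hq
  have hq0 := hU0 q hq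
  set h : ℝ → ℝ := fun s => fderiv ℝ Φs (g s * s, 1) (1, 0) with hh
  have hfield : ∀ v ∈ U, (fderiv ℝ Φs (Ψs (grad2 α v), 1) (1, 0)) • grad2 Ψs (grad2 α v)
      = (h (Ψs v) * -(fderiv ℝ Ψs v (0, 1)), h (Ψs v) * fderiv ℝ Ψs v (1, 0)) := by
    intro v hv
    have hv0 := hU0 v hv
    have hgp := hgpos _ (hΨpos v hv0)
    have e : grad2 α v = g (Ψs v) • ((-v.2, v.1) : ℝ × ℝ) := by
      unfold grad2
      rw [hαx v hv, hαy v hv]; simp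
    rw [e, hgrad _ hgp v hv0, hval _ hgp v hv0]
    rfl
  have hs := hΨpos q hq0
  have hhd : DifferentiableAt ℝ h (Ψs q) := by
    have h1 : Differentiable ℝ (fderiv ℝ Φs) :=
      (hΦsmooth.fderiv_right (m := 1) (by norm_num)).differentiable (by norm_num)
    have h2 : DifferentiableAt ℝ (fun s : ℝ => ((g s * s, 1) : ℝ × ℝ)) (Ψs q) :=
      ((hg _ hs).differentiableAt.mul differentiableAt_id).prodMk (differentiableAt_const _)
    have h3 : DifferentiableAt ℝ (fun s : ℝ => fderiv ℝ Φs (g s * s, 1)) (Ψs q) :=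
      DifferentiableAt.comp (g := fderiv ℝ Φs) (Ψs q) (h1 _) h2
    exact h3.clm_apply (differentiableAt_const _)
  have hk : HasFDerivAt (fun v => h (Ψs v)) (deriv h (Ψs q) • fderiv ℝ Ψs q) q :=
    hhd.hasDerivAt.comp_hasFDerivAt q (hD q hq0).hasFDerivAt
  have hDD : DifferentiableAt ℝ (fderiv ℝ Ψs) q :=
    ((hC q hq0).fderiv_right (m := 1) (by norm_num)).differentiableAt (by norm_num)
  have hsymm : fderiv ℝ (fderiv ℝ Ψs) q (1, 0) (0, 1) = fderiv ℝ (fderiv ℝ Ψs) q (0, 1) (1, 0) :=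
    ((hC q hq0).isSymmSndFDerivAt (by simp)).eq _ _
  have hx : ∀ w : ℝ × ℝ, HasFDerivAt (fun v => fderiv ℝ Ψs v w)
      ((ContinuousLinearMap.apply ℝ ℝ w).comp (fderiv ℝ (fderiv ℝ Ψs) q)) q := fun w =>
    (ContinuousLinearMap.apply ℝ ℝ w).hasFDerivAt.comp q hDD.hasFDerivAt
  have hF1 := hk.mul (hx (0, 1)).neg
  have hF2 := hk.mul (hx (1, 0))
  have c1 : (fun v => ((fderiv ℝ Φs (Ψs (grad2 α v), 1) (1, 0)) • grad2 Ψs (grad2 α v)).1)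
      =ᶠ[nhds q] ((fun v => h (Ψs v)) * -(fun v => (fderiv ℝ Ψs v (0, 1)))) := by
    filter_upwards [hU.mem_nhds hq] with v hv
    rw [hfield v hv]; rfl
  have c2 : (fun v => ((fderiv ℝ Φs (Ψs (grad2 α v), 1) (1, 0)) • grad2 Ψs (grad2 α v)).2)
      =ᶠ[nhds q] ((fun v => h (Ψs v)) * (fun v => fderiv ℝ Ψs v (1, 0))) := by
    filter_upwards [hU.mem_nhds hq] with v hv
    rw [hfield v hv]; rfl
  unfold div2
  rw [(hF1.congr_of_eventuallyEq c1).fderiv, (hF2.congr_of_eventuallyEq c2).fderiv]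
  simp [hsymm]
  ring
end
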